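/- arXiv:1411.1915 — 3 statements merged into one kernel-verified Lean document; each statement's English description precedes it below -/
import Mathlib

section
/- Let k ≥ 1 be an integer, R > 0, and let x ∈ ℝ^{k+1} be a fixed point with |x| ≠ R. For all complex numbers α, β with α + β = k, the surface integrals of the complex powers of the spherical ratio coincide: ∫_{S^k(R)} ω(x,y)^α dS_y = ∫_{S^k(R)} ω(x,y)^β dS_y. -/
open MeasureTheory

/-- The spherical ratio of the point `x` and a point `y` on the sphere of radius `R`
centered at the origin: `ω(x,y) = |‖x‖² − R²| / ‖x − y‖²`. -/
noncomputable def sRatio {n : ℕ} (R : ℝ) (x y : EuclideanSpace ℝ (Fin n)) : ℝ :=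
  |‖x‖ ^ 2 - R ^ 2| / ‖x - y‖ ^ 2

open Function Set Filter Topology
open scoped NNReal ENNReal

/-- If `c` is a conformal factor controlling the distortion of distances by `f`, in the sense that
`dist (f y) (f z) ≤ c y * c z * dist y z`, then `c ^ (2 * k)` bounds the Jacobian of `f` with
respect to the `k`-dimensional Hausdorff measure. -/
theorem hausdorffMeasure_image_le_lintegral {X Y : Type*} [MetricSpace X] [MeasurableSpace X]
    [BorelSpace X] [MetricSpace Y] [MeasurableSpace Y] [BorelSpace Y]
    (k : ℕ) {f : X → Y} {c : X → ℝ≥0} (hc : Measurable c) {s : Set X} (hs : MeasurableSet s)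
    (hpos : ∀ y ∈ s, c y ≠ 0)
    (hf : ∀ y ∈ s, ∀ z ∈ s, nndist (f y) (f z) ≤ c y * c z * nndist y z) :
    μH[(k : ℝ)] (f '' s) ≤ ∫⁻ y in s, ((c y ^ (2 * k) : ℝ≥0) : ℝ≥0∞) ∂μH[(k : ℝ)] := by
  have key : ∀ t : ℝ≥0, 1 < t → μH[(k : ℝ)] (f '' s) ≤
      (t ^ (2 * k) : ℝ≥0) * ∫⁻ y in s, ((c y ^ (2 * k) : ℝ≥0) : ℝ≥0∞) ∂μH[(k : ℝ)] := by
    intro t ht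
    have ht0 : t ≠ 0 := (zero_lt_one.trans ht).ne'
    let A : ℤ → Set X := fun n => s ∩ c ⁻¹' Ico (t ^ n) (t ^ (n + 1))
    have hA : ∀ n, MeasurableSet (A n) := fun n => hs.inter (hc measurableSet_Ico)
    have hmono : Monotone fun n : ℤ => t ^ n := zpow_right_mono₀ ht.le
    have hdisj : Pairwise (Disjoint on A) := by
      intro m n hmn
      have h := hmono.pairwise_disjoint_on_Ico_succ hmn
      exact ((h.preimage c).inter_left' s).inter_right' s
    have hUnion : s = ⋃ n, A n := by
      ext y
      simp only [A, mem_iUnion, mem_inter_iff, exists_and_left, mem_preimage]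
      exact ⟨fun hy => ⟨hy, NNReal.exists_mem_Ico_zpow (hpos y hy) ht⟩, fun hy => hy.1⟩
    have hpiece : ∀ n, μH[(k : ℝ)] (f '' A n) ≤
        (t ^ (2 * k) : ℝ≥0) * ∫⁻ y in A n, ((c y ^ (2 * k) : ℝ≥0) : ℝ≥0∞) ∂μH[(k : ℝ)] := by
      intro n
      have hlip : LipschitzOnWith (t ^ (n + 1) * t ^ (n + 1)) f (A n) := by
        refine LipschitzOnWith.of_dist_le_mul fun y hy z hz => ?_
        have h : nndist (f y) (f z) ≤ t ^ (n + 1) * t ^ (n + 1) * nndist y z := by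
          refine (hf y hy.1 z hz.1).trans ?_
          gcongr
          · exact hy.2.2.le
          · exact hz.2.2.le
        exact_mod_cast h
      calc μH[(k : ℝ)] (f '' A n)
          ≤ ((t ^ (n + 1) * t ^ (n + 1) : ℝ≥0) : ℝ≥0∞) ^ (k : ℝ) * μH[(k : ℝ)] (A n) :=
            hlip.hausdorffMeasure_image_le (Nat.cast_nonneg k)
        _ = (t ^ (2 * k) : ℝ≥0) * ∫⁻ _ in A n, (((t ^ n) ^ (2 * k) : ℝ≥0) : ℝ≥0∞)
              ∂μH[(k : ℝ)] := by
            rw [setLIntegral_const, ← mul_assoc, ENNReal.rpow_natCast, ← ENNReal.coe_pow,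
              ← ENNReal.coe_mul]
            congr 2
            rw [zpow_add_one₀ ht0]
            ring
        _ ≤ _ := by
            refine mul_le_mul' le_rfl (setLIntegral_mono' (hA n) fun y hy => ?_)
            have := hy.2.1
            gcongr
    calc μH[(k : ℝ)] (f '' s) = μH[(k : ℝ)] (⋃ n, f '' A n) := by
          rw [← image_iUnion, ← hUnion]
      _ ≤ ∑' n, μH[(k : ℝ)] (f '' A n) := measure_iUnion_le _
      _ ≤ ∑' n, (t ^ (2 * k) : ℝ≥0) *
            ∫⁻ y in A n, ((c y ^ (2 * k) : ℝ≥0) : ℝ≥0∞) ∂μH[(k : ℝ)] :=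
          ENNReal.tsum_le_tsum hpiece
      _ = _ := by
          rw [ENNReal.tsum_mul_left, ← lintegral_iUnion hA hdisj, ← hUnion]
  have hlim : Tendsto (fun t : ℝ≥0 => ((t ^ (2 * k) : ℝ≥0) : ℝ≥0∞) *
      ∫⁻ y in s, ((c y ^ (2 * k) : ℝ≥0) : ℝ≥0∞) ∂μH[(k : ℝ)]) (𝓝[>] 1)
      (𝓝 (((1 ^ (2 * k) : ℝ≥0) : ℝ≥0∞) *
        ∫⁻ y in s, ((c y ^ (2 * k) : ℝ≥0) : ℝ≥0∞) ∂μH[(k : ℝ)])) := by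
    refine ENNReal.Tendsto.mul_const ?_ (Or.inl (by simp))
    exact ENNReal.tendsto_coe.2 ((continuous_pow (2 * k)).continuousWithinAt.tendsto)
  have h := ge_of_tendsto hlim (eventually_nhdsWithin_of_forall key)
  simpa using h

/-- A conformal involution of a set, with conformal factor `c`, pushes the `k`-dimensional
Hausdorff measure forward to the measure with density `c ^ (2 * k)`. -/
theorem map_hausdorffMeasure_restrict_eq_withDensity {X : Type*} [MetricSpace X]
    [MeasurableSpace X] [BorelSpace X] (k : ℕ) {f : X → X} (hinv : Involutive f)
    (hfm : Measurable f) {c : X → ℝ≥0} (hc : Measurable c) {s : Set X} (hs : MeasurableSet s)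
    (hfs : MapsTo f s s) (hcf : ∀ y ∈ s, c (f y) * c y = 1)
    (hf : ∀ y ∈ s, ∀ z ∈ s, nndist (f y) (f z) ≤ c y * c z * nndist y z) :
    (μH[(k : ℝ)].restrict s).map f =
      (μH[(k : ℝ)].restrict s).withDensity fun y => ((c y ^ (2 * k) : ℝ≥0) : ℝ≥0∞) := by
  set μ : Measure X := μH[(k : ℝ)].restrict s with hμ
  have hw : Measurable fun y => ((c y ^ (2 * k) : ℝ≥0) : ℝ≥0∞) := by fun_prop
  have hpos : ∀ y ∈ s, c y ≠ 0 := fun y hy => right_ne_zero_of_mul_eq_one (hcf y hy)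
  have hle : μ.map f ≤ μ.withDensity fun y => ((c y ^ (2 * k) : ℝ≥0) : ℝ≥0∞) := by
    refine Measure.le_iff.2 fun A hA => ?_
    rw [Measure.map_apply hfm hA, withDensity_apply _ hA, hμ, Measure.restrict_apply (hfm hA),
      Measure.restrict_restrict hA]
    have himage : f ⁻¹' A ∩ s = f '' (A ∩ s) := by
      ext y
      constructor
      · exact fun hy => ⟨f y, ⟨hy.1, hfs hy.2⟩, hinv y⟩
      · rintro ⟨z, hz, rfl⟩
        exact ⟨by simpa [hinv z] using hz.1, hfs hz.2⟩
    rw [himage]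
    exact hausdorffMeasure_image_le_lintegral k hc (hA.inter hs) (fun y hy => hpos y hy.2)
      fun y hy z hz => hf y hy.2 z hz.2
  refine le_antisymm hle (Measure.le_iff.2 fun A hA => ?_)
  have hmm : (μ.map f).map f = μ := by
    rw [Measure.map_map hfm hfm, hinv.comp_self, Measure.map_id]
  set g : X → ℝ≥0∞ := A.indicator fun y => ((c y ^ (2 * k) : ℝ≥0) : ℝ≥0∞) with hg
  have hgm : Measurable g := hw.indicator hA
  calc μ.withDensity (fun y => ((c y ^ (2 * k) : ℝ≥0) : ℝ≥0∞)) A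
      = ∫⁻ y, g y ∂μ := by rw [withDensity_apply _ hA, lintegral_indicator hA]
    _ = ∫⁻ y, g (f y) ∂(μ.map f) := by
        conv_lhs => rw [← hmm]
        exact lintegral_map hgm hfm
    _ ≤ ∫⁻ y, g (f y) ∂(μ.withDensity fun y => ((c y ^ (2 * k) : ℝ≥0) : ℝ≥0∞)) :=
        lintegral_mono' hle le_rfl
    _ = ∫⁻ y in s, ((c y ^ (2 * k) : ℝ≥0) : ℝ≥0∞) * g (f y) ∂μH[(k : ℝ)] :=
        lintegral_withDensity_eq_lintegral_mul _ hw (hgm.comp hfm)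
    _ = ∫⁻ y in s, (f ⁻¹' A).indicator 1 y ∂μH[(k : ℝ)] := by
        refine setLIntegral_congr_fun hs fun y hy => ?_
        by_cases hyA : f y ∈ A
        · have h : c y ^ (2 * k) * c (f y) ^ (2 * k) = 1 := by
            rw [← mul_pow, mul_comm, hcf y hy, one_pow]
          simp only [hg, indicator_of_mem hyA, indicator_of_mem (mem_preimage.2 hyA),
            Pi.one_apply, ← ENNReal.coe_mul, h, ENNReal.coe_one]
        · simp [hg, hyA]
    _ = μ.map f A := by
        rw [lintegral_indicator_one (hfm hA), Measure.map_apply hfm hA]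

/-- The inversion of signed power `p` about the point `x`. -/
noncomputable def powerInversion {E : Type*} [NormedAddCommGroup E] [NormedSpace ℝ E]
    (x : E) (p : ℝ) (y : E) : E :=
  x + (p / ‖y - x‖ ^ 2) • (y - x)

section PowerInversion

variable {E : Type*} [NormedAddCommGroup E] [InnerProductSpace ℝ E] {x y z : E} {p R : ℝ}

theorem norm_powerInversion_sub : ‖powerInversion x p y - x‖ = |p| / ‖y - x‖ := by
  rcases eq_or_ne ‖y - x‖ 0 with h | h
  · simp [powerInversion, h]
  · rw [powerInversion, add_sub_cancel_left, norm_smul, Real.norm_eq_abs, abs_div,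
      abs_of_nonneg (sq_nonneg ‖y - x‖)]
    field_simp

theorem powerInversion_involutive (hp : p ≠ 0) : Involutive (powerInversion x p) := by
  intro y
  rcases eq_or_ne y x with rfl | h
  · simp [powerInversion]
  · have h0 : ‖y - x‖ ≠ 0 := norm_ne_zero_iff.2 (sub_ne_zero.2 h)
    rw [powerInversion, norm_powerInversion_sub, div_pow, sq_abs, powerInversion,
      add_sub_cancel_left, smul_smul]
    have : p / (p ^ 2 / ‖y - x‖ ^ 2) * (p / ‖y - x‖ ^ 2) = 1 := by field_simp
    rw [this, one_smul, add_sub_cancel]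

theorem dist_powerInversion (hy : y ≠ x) (hz : z ≠ x) :
    dist (powerInversion x p y) (powerInversion x p z) =
      |p| / (‖y - x‖ * ‖z - x‖) * dist y z := by
  have h := dist_div_norm_sq_smul (sub_ne_zero.2 hy) (sub_ne_zero.2 hz) 1
  rw [powerInversion, powerInversion, dist_add_left]
  have e : ∀ v : E, (p / ‖v‖ ^ 2) • v = p • ((1 / ‖v‖) ^ 2 • v) := fun v => by
    rw [smul_smul]; congr 1; ring
  rw [e, e, dist_smul₀, h, dist_sub_right, Real.norm_eq_abs]
  ring

theorem powerInversion_mapsTo_sphere (hx : ‖x‖ ≠ R) :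
    MapsTo (powerInversion x (‖x‖ ^ 2 - R ^ 2)) (Metric.sphere 0 R) (Metric.sphere 0 R) := by
  intro y hy
  rw [mem_sphere_zero_iff_norm] at hy ⊢
  have hR : 0 ≤ R := hy ▸ norm_nonneg y
  have h0 : ‖y - x‖ ≠ 0 := norm_ne_zero_iff.2 (sub_ne_zero.2 (by rintro rfl; exact hx hy))
  have h1 : R ^ 2 = ‖x‖ ^ 2 + 2 * inner ℝ x (y - x) + ‖y - x‖ ^ 2 := by
    rw [← norm_add_sq_real, add_sub_cancel, hy]
  rw [← sq_eq_sq₀ (norm_nonneg _) hR, powerInversion, norm_add_sq_real, inner_smul_right,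
    norm_smul, mul_pow, Real.norm_eq_abs, sq_abs]
  have h2 : inner ℝ x (y - x) = (R ^ 2 - ‖x‖ ^ 2 - ‖y - x‖ ^ 2) / 2 := by linarith
  rw [h2]
  field_simp
  ring

theorem measurable_powerInversion [MeasurableSpace E] [BorelSpace E]
    [SecondCountableTopology E] : Measurable (powerInversion x p) := by
  unfold powerInversion
  fun_prop

end PowerInversion

theorem stmt_0 (k : ℕ) (hk : 1 ≤ k) (R : ℝ) (hR : 0 < R)
    (x : EuclideanSpace ℝ (Fin (k + 1))) (hx : ‖x‖ ≠ R)
    (α β : ℂ) (hαβ : α + β = (k : ℂ)) :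
    ∫ y in Metric.sphere (0 : EuclideanSpace ℝ (Fin (k + 1))) R,
        Complex.exp (α * (Real.log (sRatio R x y) : ℂ)) ∂(μH[(k : ℝ)]) =
    ∫ y in Metric.sphere (0 : EuclideanSpace ℝ (Fin (k + 1))) R,
        Complex.exp (β * (Real.log (sRatio R x y) : ℂ)) ∂(μH[(k : ℝ)]) := by
  set p : ℝ := ‖x‖ ^ 2 - R ^ 2 with hp_def
  have hp : p ≠ 0 := by
    rw [hp_def, sub_ne_zero, Ne, sq_eq_sq₀ (norm_nonneg x) hR.le]
    exact hx
  have hp' : 0 < |p| := abs_pos.2 hp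
  set S := Metric.sphere (0 : EuclideanSpace ℝ (Fin (k + 1))) R with hS_def
  have hS : MeasurableSet S := Metric.isClosed_sphere.measurableSet
  have hne : ∀ y ∈ S, y ≠ x := by
    rintro y hy rfl
    exact hx (mem_sphere_zero_iff_norm.1 hy)
  have hnorm : ∀ y ∈ S, 0 < ‖y - x‖ := fun y hy => norm_pos_iff.2 (sub_ne_zero.2 (hne y hy))
  have hinv : Involutive (powerInversion x p) := powerInversion_involutive hp
  have hfm : Measurable (powerInversion x p) := measurable_powerInversion
  have hfS : MapsTo (powerInversion x p) S S := powerInversion_mapsTo_sphere hx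
  let c : EuclideanSpace ℝ (Fin (k + 1)) → ℝ≥0 := fun y =>
    NNReal.sqrt (Real.toNNReal |p|) / ‖y - x‖₊
  have hc : Measurable c := by fun_prop
  have hcoe : ∀ y, (c y : ℝ) = √|p| / ‖y - x‖ := fun y => by
    simp [c, Real.coe_sqrt]
  have hsq : √|p| * √|p| = |p| := Real.mul_self_sqrt hp'.le
  have hmap := map_hausdorffMeasure_restrict_eq_withDensity k hinv hfm hc hS hfS
    (fun y hy => by
      have h0 := hnorm y hy
      rw [← NNReal.coe_inj, NNReal.coe_mul, hcoe, hcoe, norm_powerInversion_sub, NNReal.coe_one]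
      field_simp
      linarith)
    (fun y hy z hz => by
      rw [← NNReal.coe_le_coe, NNReal.coe_mul, NNReal.coe_mul, hcoe, hcoe, coe_nndist, coe_nndist,
        dist_powerInversion (hne y hy) (hne z hz), div_mul_div_comm, hsq])
  have hratio : ∀ y, sRatio R x y = (c y : ℝ) ^ 2 := fun y => by
    rw [hcoe, div_pow, sq √|p|, hsq, sRatio, norm_sub_rev x y]
  have hpos : ∀ y ∈ S, 0 < sRatio R x y := fun y hy => by
    have := hnorm y hy
    rw [hratio, hcoe]
    positivity
  have hinvratio : ∀ y ∈ S, sRatio R x (powerInversion x p y) = (sRatio R x y)⁻¹ := fun y hy => by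
    have := hnorm y hy
    rw [sRatio, sRatio, norm_sub_rev, norm_powerInversion_sub, norm_sub_rev x y, ← hp_def]
    field_simp
  calc ∫ y in S, Complex.exp (α * (Real.log (sRatio R x y) : ℂ)) ∂(μH[(k : ℝ)])
      = ∫ y in S, Complex.exp (-α * (Real.log (sRatio R x (powerInversion x p y)) : ℂ))
          ∂(μH[(k : ℝ)]) := by
        refine setIntegral_congr_fun hS fun y hy => ?_
        simp only [hinvratio y hy, Real.log_inv]
        push_cast
        rw [neg_mul_neg]
    _ = ∫ y, Complex.exp (-α * (Real.log (sRatio R x y) : ℂ))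
          ∂((μH[(k : ℝ)].restrict S).map (powerInversion x p)) :=
        (integral_map_equiv (MeasurableEquiv.ofInvolutive _ hinv hfm)
          fun y => Complex.exp (-α * (Real.log (sRatio R x y) : ℂ))).symm
    _ = ∫ y in S, (c y ^ (2 * k)) • Complex.exp (-α * (Real.log (sRatio R x y) : ℂ))
          ∂(μH[(k : ℝ)]) := by
        rw [hmap]
        exact integral_withDensity_eq_integral_smul (by fun_prop) _
    _ = _ := by
        refine setIntegral_congr_fun hS fun y hy => ?_
        have hexp : ((c y ^ (2 * k) : ℝ≥0) : ℂ) =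
            Complex.exp (k * (Real.log (sRatio R x y) : ℂ)) := by
          rw [Complex.exp_nat_mul, ← Complex.ofReal_exp, Real.exp_log (hpos y hy), hratio]
          push_cast
          rw [pow_mul]
        simp only [NNReal.smul_def, Complex.real_smul]
        rw [hexp, ← Complex.exp_add, ← hαβ]
        ring_nf
end

section
/- Let k ≥ 1 be an integer, R > 0, and let x ∈ ℝ^{k+1} be a fixed point with 0 < |x| and |x| ≠ R. If α and β are real numbers satisfying ∫_{S^k(R)} ω(x,y)^α dS_y = ∫_{S^k(R)} ω(x,y)^β dS_y, then α + β = k or α = β. -/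
open MeasureTheory

section

open Metric ENNReal NNReal

lemma hausdorffMeasure_sphere_pos {k : ℕ} {R : ℝ} (hR : 0 < R) :
    0 < μH[(k : ℝ)] (sphere (0 : EuclideanSpace ℝ (Fin (k + 1))) R) := by
  set P : EuclideanSpace ℝ (Fin (k + 1)) → (Fin k → ℝ) := fun y j => y j.succ
  have hP : LipschitzWith 1 P := by
    refine LipschitzWith.of_dist_le_mul fun y z => ?_
    rw [NNReal.coe_one, one_mul, dist_pi_le_iff dist_nonneg]
    intro j
    rw [Real.dist_eq, dist_eq_norm, ← Real.norm_eq_abs]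
    exact PiLp.norm_apply_le (y - z) j.succ
  have hopen : IsOpen {v : Fin k → ℝ | ∑ j, v j ^ 2 < R ^ 2} :=
    isOpen_lt (by fun_prop) continuous_const
  have hsub : {v : Fin k → ℝ | ∑ j, v j ^ 2 < R ^ 2} ⊆
      P '' sphere (0 : EuclideanSpace ℝ (Fin (k + 1))) R := by
    intro v hv
    refine ⟨WithLp.toLp 2 (Fin.cons (√(R ^ 2 - ∑ j, v j ^ 2)) v), ?_, ?_⟩
    · rw [mem_sphere_zero_iff_norm, ← sq_eq_sq₀ (norm_nonneg _) hR.le, EuclideanSpace.real_norm_sq_eq,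
        Fin.sum_univ_succ]
      simp [Real.sq_sqrt (sub_nonneg.2 (le_of_lt hv))]
    · ext j
      simp [P]
  have hpos : 0 < μH[(k : ℝ)] {v : Fin k → ℝ | ∑ j, v j ^ 2 < R ^ 2} := by
    have := hausdorffMeasure_pi_real (ι := Fin k)
    rw [Fintype.card_fin] at this
    rw [this]
    exact hopen.measure_pos _ ⟨0, by simpa using by positivity⟩
  refine hpos.trans_le ((measure_mono hsub).trans ?_)
  simpa using hP.hausdorffMeasure_image_le (d := (k : ℝ)) (by positivity) (sphere 0 R)

lemma hausdorffMeasure_cap_lt_top {k : ℕ} {R : ℝ} (hR : 0 < R) (i : Fin (k + 1)) {σ : ℝ}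
    (hσ : σ ^ 2 = 1) :
    μH[(k : ℝ)] {y : EuclideanSpace ℝ (Fin (k + 1)) | ‖y‖ = R ∧ R / (k + 1) ≤ σ * y i} < ∞ := by
  set A := {y : EuclideanSpace ℝ (Fin (k + 1)) | ‖y‖ = R ∧ R / (k + 1) ≤ σ * y i}
  set P : A → (Fin k → ℝ) := fun y j => y.1 (i.succAbove j)
  have hP : AntilipschitzWith (k * (k + 1) + k : ℝ≥0) P := by
    refine AntilipschitzWith.of_le_mul_dist fun y z => ?_
    obtain ⟨y, hy, hyi⟩ := y
    obtain ⟨z, hz, hzi⟩ := z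
    set D := dist (P ⟨y, hy, hyi⟩) (P ⟨z, hz, hzi⟩)
    have hD : ∀ j, |y (i.succAbove j) - z (i.succAbove j)| ≤ D := fun j =>
      dist_le_pi_dist (P ⟨y, hy, hyi⟩) (P ⟨z, hz, hzi⟩) j
    have hD0 : 0 ≤ D := dist_nonneg
    have hy2 : (y i) ^ 2 + ∑ j, y (i.succAbove j) ^ 2 = R ^ 2 := by
      rw [← hy, EuclideanSpace.real_norm_sq_eq, Fin.sum_univ_succAbove _ i]
    have hz2 : (z i) ^ 2 + ∑ j, z (i.succAbove j) ^ 2 = R ^ 2 := by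
      rw [← hz, EuclideanSpace.real_norm_sq_eq, Fin.sum_univ_succAbove _ i]
    have hyR : ∀ j, |y j| ≤ R := fun j => hy ▸ PiLp.norm_apply_le y j
    have hzR : ∀ j, |z j| ≤ R := fun j => hz ▸ PiLp.norm_apply_le z j
    have hk : (0 : ℝ) < k + 1 := by positivity
    have key : |y i - z i| ≤ k * (k + 1) * D := by
      have e : (y i - z i) * (y i + z i) =
          ∑ j, (z (i.succAbove j) - y (i.succAbove j)) * (z (i.succAbove j) + y (i.succAbove j)) := by
        have : ∀ j, (z (i.succAbove j) - y (i.succAbove j)) * (z (i.succAbove j) + y (i.succAbove j))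
          = z (i.succAbove j) ^ 2 - y (i.succAbove j) ^ 2 := fun j => by ring
        simp only [this, Finset.sum_sub_distrib]
        linarith
      have h1 : |(y i - z i) * (y i + z i)| ≤ k * (D * (2 * R)) := by
        rw [e]
        refine (Finset.abs_sum_le_sum_abs _ _).trans ?_
        refine (Finset.sum_le_card_nsmul _ _ (D * (2 * R)) fun j _ => ?_).trans (by simp)
        rw [abs_mul, abs_sub_comm]
        gcongr
        · exact hD j
        · exact (abs_add_le _ _).trans (by linarith [hyR (i.succAbove j), hzR (i.succAbove j)])
      have hσ' : |σ| = 1 := by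
        rw [← sq_eq_sq₀ (abs_nonneg _) one_pos.le, sq_abs, hσ, one_pow]
      have h2 : 2 * (R / (k + 1)) ≤ |y i + z i| := by
        have : |σ * (y i + z i)| = |y i + z i| := by rw [abs_mul, hσ', one_mul]
        rw [← this]
        refine le_trans ?_ (le_abs_self _)
        linarith
      have h3 : |y i - z i| * (2 * (R / (k + 1))) ≤ k * (D * (2 * R)) := by
        refine le_trans ?_ h1
        rw [abs_mul]
        gcongr
      have h4 : k * (D * (2 * R)) = k * (k + 1) * D * (2 * (R / (k + 1))) := by
        field_simp
      rw [h4] at h3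
      exact le_of_mul_le_mul_right h3 (by positivity)
    rw [Subtype.dist_eq, dist_eq_norm]
    refine le_of_sq_le_sq ?_ (by positivity)
    rw [EuclideanSpace.real_norm_sq_eq, Fin.sum_univ_succAbove _ i]
    have h5 : ∑ j, (y - z) (i.succAbove j) ^ 2 ≤ k * D ^ 2 := by
      refine (Finset.sum_le_card_nsmul _ _ (D ^ 2) fun j _ => ?_).trans (by simp)
      exact sq_le_sq' (abs_le.1 (hD j)).1 (abs_le.1 (hD j)).2
    have h6 : (y - z) i ^ 2 ≤ (k * (k + 1) * D) ^ 2 := by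
      rw [← sq_abs]
      exact pow_le_pow_left₀ (abs_nonneg _) key 2
    have h7 : (k : ℝ) ≤ (k : ℝ) ^ 2 := by
      exact_mod_cast Nat.le_self_pow two_ne_zero k
    push_cast
    have : (0:ℝ) ≤ k * (k + 1) * k := by positivity
    nlinarith [sq_nonneg D]
  have h1 := hP.le_hausdorffMeasure_image (d := (k : ℝ)) (by positivity) Set.univ
  have h2 := (isometry_subtype_coe (s := A)).hausdorffMeasure_image (d := (k : ℝ))
    (Or.inl (by positivity)) Set.univ
  rw [Set.image_univ, Subtype.range_coe] at h2
  rw [h2]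
  refine h1.trans_lt (ENNReal.mul_lt_top
    (ENNReal.rpow_lt_top_of_nonneg (by positivity) ENNReal.coe_ne_top) ?_)
  have := hausdorffMeasure_pi_real (ι := Fin k)
  rw [Fintype.card_fin] at this
  rw [this]
  refine (measure_mono (t := closedBall 0 R) ?_).trans_lt measure_closedBall_lt_top
  rintro _ ⟨⟨y, hy, -⟩, -, rfl⟩
  rw [mem_closedBall_zero_iff, pi_norm_le_iff_of_nonneg hR.le]
  exact fun j => hy ▸ PiLp.norm_apply_le y _

lemma hausdorffMeasure_sphere_lt_top {k : ℕ} {R : ℝ} (hR : 0 < R) :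
    μH[(k : ℝ)] (sphere (0 : EuclideanSpace ℝ (Fin (k + 1))) R) < ∞ := by
  have hsub : sphere (0 : EuclideanSpace ℝ (Fin (k + 1))) R ⊆
      ⋃ i, ({y | ‖y‖ = R ∧ R / (k + 1) ≤ 1 * y i} ∪ {y | ‖y‖ = R ∧ R / (k + 1) ≤ (-1) * y i}) := by
    intro y hy
    rw [mem_sphere_zero_iff_norm] at hy
    have hk : (0 : ℝ) < k + 1 := by positivity
    by_contra! hc
    simp only [Set.mem_iUnion, Set.mem_union, Set.mem_ofPred_eq, hy, true_and, not_exists, not_or,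
      not_le] at hc
    have h1 : ∀ i, y i ^ 2 < (R / (k + 1)) ^ 2 := fun i =>
      sq_lt_sq' (by linarith [(hc i).2]) (by linarith [(hc i).1])
    have h2 : R ^ 2 < (k + 1) * (R / (k + 1)) ^ 2 := by
      rw [← hy, EuclideanSpace.real_norm_sq_eq, hy]
      refine (Finset.sum_lt_sum_of_nonempty Finset.univ_nonempty fun i _ => h1 i).trans_le (by simp)
    have h3 : (k + 1) * (R / (k + 1)) ^ 2 = R ^ 2 / (k + 1) := by field_simp
    rw [h3, lt_div_iff₀ hk] at h2
    have : 0 ≤ R ^ 2 * k := by positivity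
    linarith
  refine (measure_mono hsub).trans_lt ?_
  refine (measure_iUnion_le _).trans_lt ?_
  rw [tsum_fintype]
  refine ENNReal.sum_lt_top.2 fun i _ => ?_
  exact measure_union_lt_top (hausdorffMeasure_cap_lt_top hR i (by norm_num))
    (hausdorffMeasure_cap_lt_top hR i (by norm_num))

/-- The second intersection of the line through `x` and `y` with a sphere of radius `R` centered
at the origin and containing `y`. -/
noncomputable def chordMap {n : ℕ} (R : ℝ) (x y : EuclideanSpace ℝ (Fin n)) :
    EuclideanSpace ℝ (Fin n) :=
  x + ((‖x‖ ^ 2 - R ^ 2) / ‖y - x‖ ^ 2) • (y - x)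

section

variable {n : ℕ} {R : ℝ} {x y z : EuclideanSpace ℝ (Fin n)}

lemma norm_sub_pos_of_mem_sphere (hx : ‖x‖ ≠ R) (hy : y ∈ sphere 0 R) : 0 < ‖y - x‖ := by
  rw [norm_pos_iff, sub_ne_zero]
  rintro rfl
  exact hx (mem_sphere_zero_iff_norm.1 hy)

lemma power_ne_zero (hR : 0 < R) (hx : ‖x‖ ≠ R) : ‖x‖ ^ 2 - R ^ 2 ≠ 0 := by
  rw [sub_ne_zero]
  exact fun h => hx ((sq_eq_sq₀ (norm_nonneg _) hR.le).1 h)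

lemma sRatio_pos (hR : 0 < R) (hx : ‖x‖ ≠ R) (hy : y ∈ sphere 0 R) : 0 < sRatio R x y := by
  have := norm_sub_pos_of_mem_sphere hx hy
  have := power_ne_zero hR hx
  rw [sRatio, norm_sub_rev]
  positivity

lemma chordMap_mem_sphere (hR : 0 < R) (hx : ‖x‖ ≠ R) (hy : y ∈ sphere 0 R) :
    chordMap R x y ∈ sphere 0 R := by
  have hd := norm_sub_pos_of_mem_sphere hx hy
  have e : ‖y‖ ^ 2 = ‖x‖ ^ 2 + 2 * inner ℝ x (y - x) + ‖y - x‖ ^ 2 := by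
    rw [← norm_add_sq_real, add_sub_cancel]
  rw [mem_sphere_zero_iff_norm] at hy ⊢
  rw [← sq_eq_sq₀ (norm_nonneg _) hR.le, chordMap, norm_add_sq_real, norm_smul, inner_smul_right,
    mul_pow, Real.norm_eq_abs, sq_abs]
  rw [hy] at e
  have e' : 2 * inner ℝ x (y - x) = R ^ 2 - ‖x‖ ^ 2 - ‖y - x‖ ^ 2 := by linarith
  rw [mul_left_comm, e']
  field_simp
  ring

lemma norm_chordMap_sub (hx : ‖x‖ ≠ R) (hy : y ∈ sphere 0 R) :
    ‖chordMap R x y - x‖ = |‖x‖ ^ 2 - R ^ 2| / ‖y - x‖ := by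
  have hd := norm_sub_pos_of_mem_sphere hx hy
  rw [chordMap, add_sub_cancel_left, norm_smul, Real.norm_eq_abs, abs_div, abs_of_pos (pow_pos hd 2)]
  field_simp

lemma sRatio_chordMap (hR : 0 < R) (hx : ‖x‖ ≠ R) (hy : y ∈ sphere 0 R) :
    sRatio R x (chordMap R x y) = (sRatio R x y)⁻¹ := by
  have hd := norm_sub_pos_of_mem_sphere hx hy
  have hq := abs_pos.2 (power_ne_zero hR hx)
  rw [sRatio, sRatio, norm_sub_rev, norm_chordMap_sub hx hy, norm_sub_rev x y]
  field_simp

lemma chordMap_chordMap (hR : 0 < R) (hx : ‖x‖ ≠ R) (hy : y ∈ sphere 0 R) :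
    chordMap R x (chordMap R x y) = y := by
  have hd := norm_sub_pos_of_mem_sphere hx hy
  have hq := power_ne_zero hR hx
  rw [chordMap, norm_chordMap_sub hx hy, div_pow, sq_abs]
  rw [chordMap, add_sub_cancel_left, smul_smul]
  have : (‖x‖ ^ 2 - R ^ 2) / ((‖x‖ ^ 2 - R ^ 2) ^ 2 / ‖y - x‖ ^ 2) *
      ((‖x‖ ^ 2 - R ^ 2) / ‖y - x‖ ^ 2) = 1 := by
    field_simp
  rw [this, one_smul, add_sub_cancel]

lemma dist_chordMap (hx : ‖x‖ ≠ R) (hy : y ∈ sphere 0 R) (hz : z ∈ sphere 0 R) :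
    dist (chordMap R x y) (chordMap R x z) =
      |‖x‖ ^ 2 - R ^ 2| / (‖y - x‖ * ‖z - x‖) * dist y z := by
  have hyd := norm_sub_pos_of_mem_sphere hx hy
  have hzd := norm_sub_pos_of_mem_sphere hx hz
  have h := dist_div_norm_sq_smul (norm_pos_iff.1 hyd) (norm_pos_iff.1 hzd) 1
  have e : ∀ w : EuclideanSpace ℝ (Fin n), ((‖x‖ ^ 2 - R ^ 2) / ‖w - x‖ ^ 2) • (w - x) =
      (‖x‖ ^ 2 - R ^ 2) • ((1 / ‖w - x‖) ^ 2 • (w - x)) := fun w => by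
    rw [smul_smul]; congr 1; ring
  rw [chordMap, chordMap, dist_add_left, e, e, dist_smul₀, h, dist_sub_right, Real.norm_eq_abs]
  ring

lemma measurable_sRatio : Measurable (sRatio R x) := by
  unfold sRatio
  fun_prop

lemma lipschitzOnWith_chordMap {M : ℝ≥0} {A : Set (EuclideanSpace ℝ (Fin n))}
    (hx : ‖x‖ ≠ R) (hA : A ⊆ sphere 0 R) (hM : ∀ y ∈ A, sRatio R x y ≤ M) :
    LipschitzOnWith M (chordMap R x) A := by
  refine LipschitzOnWith.of_dist_le_mul fun y hy z hz => ?_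
  rw [dist_chordMap hx (hA hy) (hA hz)]
  gcongr
  have hyd := norm_sub_pos_of_mem_sphere hx (hA hy)
  have hzd := norm_sub_pos_of_mem_sphere hx (hA hz)
  have h1 := hM y hy
  have h2 := hM z hz
  rw [sRatio, norm_sub_rev, div_le_iff₀ (by positivity)] at h1 h2
  rw [div_le_iff₀ (by positivity)]
  refine le_of_sq_le_sq ?_ (by positivity)
  calc |‖x‖ ^ 2 - R ^ 2| ^ 2 = |‖x‖ ^ 2 - R ^ 2| * |‖x‖ ^ 2 - R ^ 2| := sq _
    _ ≤ (M * ‖y - x‖ ^ 2) * (M * ‖z - x‖ ^ 2) := by gcongr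
    _ = _ := by ring

lemma rpow_le_rpow_abs_mul {l m u v b : ℝ} (hm : 0 < m) (hl : 1 ≤ l) (hu : u ∈ Set.Icc m (l * m))
    (hv : v ∈ Set.Icc m (l * m)) : u ^ b ≤ l ^ |b| * v ^ b := by
  have hu0 : 0 < u := hm.trans_le hu.1
  have hv0 : 0 < v := hm.trans_le hv.1
  have hl0 : 0 < l := one_pos.trans_le hl
  rcases le_total 0 b with hb | hb
  · rw [abs_of_nonneg hb, ← Real.mul_rpow hl0.le hv0.le]
    refine Real.rpow_le_rpow hu0.le (hu.2.trans ?_) hb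
    gcongr
    exact hv.1
  · rw [abs_of_nonpos hb, Real.rpow_neg hl0.le, ← Real.inv_rpow hl0.le,
      ← Real.mul_rpow (inv_nonneg.2 hl0.le) hv0.le]
    refine Real.rpow_le_rpow_of_nonpos (by positivity) ?_ hb
    rw [inv_mul_le_iff₀ hl0]
    refine hv.2.trans ?_
    gcongr
    exact hu.1

lemma lintegral_image_chordMap_le {k : ℝ} (hk : 0 ≤ k) {a l m : ℝ}
    {A : Set (EuclideanSpace ℝ (Fin n))} (hR : 0 < R) (hx : ‖x‖ ≠ R) (hA : A ⊆ sphere 0 R)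
    (hAm : MeasurableSet A) (hm : 0 < m) (hl : 1 ≤ l)
    (h : ∀ y ∈ A, sRatio R x y ∈ Set.Icc m (l * m)) :
    ∫⁻ y in chordMap R x '' A, ENNReal.ofReal (sRatio R x y ^ a) ∂μH[k] ≤
      ENNReal.ofReal (l ^ (2 * |a| + k)) *
        ∫⁻ y in A, ENNReal.ofReal (sRatio R x y ^ (k - a)) ∂μH[k] := by
  have hl0 : 0 < l := one_pos.trans_le hl
  have hmm : m ∈ Set.Icc m (l * m) := ⟨le_rfl, le_mul_of_one_le_left hm.le hl⟩
  have hlm : 0 < l * m := by positivity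
  calc ∫⁻ y in chordMap R x '' A, ENNReal.ofReal (sRatio R x y ^ a) ∂μH[k]
      ≤ ∫⁻ y in chordMap R x '' A, ENNReal.ofReal (l ^ |a| * m ^ (-a)) ∂μH[k] := by
        refine setLIntegral_mono measurable_const ?_
        rintro _ ⟨y, hy, rfl⟩
        refine ENNReal.ofReal_le_ofReal ?_
        rw [sRatio_chordMap hR hx (hA hy), Real.inv_rpow (sRatio_pos hR hx (hA hy)).le,
          ← Real.rpow_neg (sRatio_pos hR hx (hA hy)).le, ← abs_neg a]
        exact rpow_le_rpow_abs_mul hm hl (h y hy) hmm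
    _ = ENNReal.ofReal (l ^ |a| * m ^ (-a)) * μH[k] (chordMap R x '' A) := setLIntegral_const _ _
    _ ≤ ENNReal.ofReal (l ^ |a| * m ^ (-a)) * (ENNReal.ofReal ((l * m) ^ k) * μH[k] A) := by
        gcongr
        have := (lipschitzOnWith_chordMap (M := (l * m).toNNReal) hx hA fun y hy => by
          rw [Real.coe_toNNReal _ hlm.le]; exact (h y hy).2).hausdorffMeasure_image_le hk
        rwa [← ENNReal.ofReal_rpow_of_nonneg hlm.le hk]
    _ = ∫⁻ y in A, ENNReal.ofReal (l ^ |a| * m ^ (-a) * (l * m) ^ k) ∂μH[k] := by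
        rw [setLIntegral_const, ← mul_assoc, ← ENNReal.ofReal_mul (by positivity)]
    _ ≤ ∫⁻ y in A, ENNReal.ofReal (l ^ (2 * |a| + k)) *
          ENNReal.ofReal (sRatio R x y ^ (k - a)) ∂μH[k] := by
        refine setLIntegral_mono' hAm fun y hy => ?_
        rw [← ENNReal.ofReal_mul (by positivity)]
        refine ENNReal.ofReal_le_ofReal ?_
        have h0 := sRatio_pos hR hx (hA hy)
        have h1 := rpow_le_rpow_abs_mul (b := -a) hm hl hmm (h y hy)
        have h2 : m ^ k ≤ sRatio R x y ^ k := Real.rpow_le_rpow hm.le (h y hy).1 hk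
        rw [abs_neg] at h1
        calc l ^ |a| * m ^ (-a) * (l * m) ^ k
            ≤ l ^ |a| * (l ^ |a| * sRatio R x y ^ (-a)) * (l ^ k * sRatio R x y ^ k) := by
              rw [Real.mul_rpow hl0.le hm.le]
              gcongr
          _ = l ^ (2 * |a| + k) * sRatio R x y ^ (k - a) := by
              rw [Real.rpow_add hl0, two_mul, Real.rpow_add hl0, sub_eq_add_neg, Real.rpow_add h0]
              ring
    _ = _ := lintegral_const_mul _ (by have := measurable_sRatio (R := R) (x := x); fun_prop)

lemma lintegral_sRatio_le_mul {k : ℝ} (hk : 0 ≤ k) (a : ℝ) {l : ℝ} (hR : 0 < R) (hx : ‖x‖ ≠ R)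
    (hl : 1 < l) :
    ∫⁻ y in sphere 0 R, ENNReal.ofReal (sRatio R x y ^ a) ∂μH[k] ≤
      ENNReal.ofReal (l ^ (2 * |a| + k)) *
        ∫⁻ y in sphere 0 R, ENNReal.ofReal (sRatio R x y ^ (k - a)) ∂μH[k] := by
  have hl0 : 0 < l := one_pos.trans hl
  set A : ℤ → Set (EuclideanSpace ℝ (Fin n)) := fun i =>
    sphere 0 R ∩ sRatio R x ⁻¹' Set.Ico (l ^ i) (l ^ (i + 1))
  have hAm : ∀ i, MeasurableSet (A i) := fun i =>
    isClosed_sphere.measurableSet.inter (measurable_sRatio measurableSet_Ico)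
  have hAU : ⋃ i, A i = sphere 0 R := by
    refine Set.Subset.antisymm (Set.iUnion_subset fun i => Set.inter_subset_left) fun y hy => ?_
    obtain ⟨i, hi⟩ := exists_mem_Ico_zpow (sRatio_pos hR hx hy) hl
    exact Set.mem_iUnion.2 ⟨i, hy, hi⟩
  have hAd : Pairwise (Function.onFun Disjoint A) := fun i j hij =>
    (((zpow_right_mono₀ hl.le).pairwise_disjoint_on_Ico_succ hij).preimage _).mono Set.inter_subset_right
      Set.inter_subset_right
  have hsub : sphere 0 R ⊆ ⋃ i, chordMap R x '' A i := by
    intro y hy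
    have hy' := chordMap_mem_sphere hR hx hy
    rw [← hAU, Set.mem_iUnion] at hy'
    obtain ⟨i, hi⟩ := hy'
    exact Set.mem_iUnion.2 ⟨i, _, hi, chordMap_chordMap hR hx hy⟩
  calc ∫⁻ y in sphere 0 R, ENNReal.ofReal (sRatio R x y ^ a) ∂μH[k]
      ≤ ∫⁻ y in ⋃ i, chordMap R x '' A i, ENNReal.ofReal (sRatio R x y ^ a) ∂μH[k] :=
        lintegral_mono_set hsub
    _ ≤ ∑' i, ∫⁻ y in chordMap R x '' A i, ENNReal.ofReal (sRatio R x y ^ a) ∂μH[k] :=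
        lintegral_iUnion_le _ _
    _ ≤ ∑' i, ENNReal.ofReal (l ^ (2 * |a| + k)) *
          ∫⁻ y in A i, ENNReal.ofReal (sRatio R x y ^ (k - a)) ∂μH[k] := by
        refine ENNReal.tsum_le_tsum fun i => ?_
        refine lintegral_image_chordMap_le hk hR hx Set.inter_subset_left (hAm i)
          (zpow_pos hl0 i) hl.le fun y hy => ⟨hy.2.1, ?_⟩
        rw [← zpow_one_add₀ hl0.ne', add_comm]
        exact hy.2.2.le
    _ = _ := by rw [ENNReal.tsum_mul_left, ← lintegral_iUnion hAm hAd, hAU]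

lemma lintegral_sRatio_le {k : ℝ} (hk : 0 ≤ k) (a : ℝ) (hR : 0 < R) (hx : ‖x‖ ≠ R) :
    ∫⁻ y in sphere 0 R, ENNReal.ofReal (sRatio R x y ^ a) ∂μH[k] ≤
      ∫⁻ y in sphere 0 R, ENNReal.ofReal (sRatio R x y ^ (k - a)) ∂μH[k] := by
  have hlim : Filter.Tendsto (fun l : ℝ => ENNReal.ofReal (l ^ (2 * |a| + k)) *
      ∫⁻ y in sphere 0 R, ENNReal.ofReal (sRatio R x y ^ (k - a)) ∂μH[k])
      (nhdsWithin 1 (Set.Ioi 1)) (nhds (1 *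
      ∫⁻ y in sphere 0 R, ENNReal.ofReal (sRatio R x y ^ (k - a)) ∂μH[k])) := by
    refine ENNReal.Tendsto.mul_const ?_ (Or.inl one_ne_zero)
    have : Filter.Tendsto (fun l : ℝ => l ^ (2 * |a| + k)) (nhdsWithin 1 (Set.Ioi 1)) (nhds 1) := by
      have := (Real.continuousAt_rpow_const 1 (2 * |a| + k) (Or.inl one_ne_zero)).tendsto
      rw [Real.one_rpow] at this
      exact this.mono_left nhdsWithin_le_nhds
    simpa using ENNReal.tendsto_ofReal this
  rw [one_mul] at hlim
  refine ge_of_tendsto hlim ?_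
  filter_upwards [self_mem_nhdsWithin] with l hl
  exact lintegral_sRatio_le_mul hk a hR hx hl

lemma integral_sRatio_eq {k : ℝ} (hk : 0 ≤ k) (a : ℝ) (hR : 0 < R) (hx : ‖x‖ ≠ R) :
    ∫ y in sphere 0 R, sRatio R x y ^ (k - a) ∂μH[k] =
      ∫ y in sphere 0 R, sRatio R x y ^ a ∂μH[k] := by
  have e : ∀ b : ℝ, ∫ y in sphere 0 R, sRatio R x y ^ b ∂μH[k] =
      (∫⁻ y in sphere 0 R, ENNReal.ofReal (sRatio R x y ^ b) ∂μH[k]).toReal := fun b =>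
    integral_eq_lintegral_of_nonneg_ae
      (Filter.Eventually.of_forall fun y => Real.rpow_nonneg (by unfold sRatio; positivity) _)
      (measurable_sRatio.pow_const b).aestronglyMeasurable
  rw [e, e]
  congr 1
  refine le_antisymm ?_ (lintegral_sRatio_le hk a hR hx)
  simpa using lintegral_sRatio_le hk (k - a) hR hx

end

section

variable {k : ℕ} {R : ℝ} {x : EuclideanSpace ℝ (Fin (k + 1))}

lemma integrableOn_sRatio_rpow (hR : 0 < R) (hx : ‖x‖ ≠ R) (a : ℝ) :
    IntegrableOn (fun y => sRatio R x y ^ a) (sphere 0 R) μH[(k : ℝ)] := by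
  have hc : ContinuousOn (fun y => sRatio R x y ^ a) (sphere 0 R) := by
    refine ContinuousOn.rpow_const (ContinuousOn.div (by fun_prop) (by fun_prop) fun y hy => ?_)
      fun y hy => Or.inl (sRatio_pos hR hx hy).ne'
    rw [norm_sub_rev]
    exact (pow_pos (norm_sub_pos_of_mem_sphere hx hy) 2).ne'
  obtain ⟨C, hC⟩ := (isCompact_sphere 0 R).exists_bound_of_continuousOn hc
  refine Measure.integrableOn_of_bounded (hausdorffMeasure_sphere_lt_top hR).ne
    (measurable_sRatio.pow_const a).aestronglyMeasurable (M := C) ?_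
  filter_upwards [ae_restrict_mem isClosed_sphere.measurableSet] with y hy using hC y hy

lemma hausdorffMeasure_hemisphere_pos (hR : 0 < R) :
    0 < μH[(k : ℝ)] (sphere 0 R ∩ {y | inner ℝ x y ≤ 0}) := by
  set A := sphere 0 R ∩ {y | inner ℝ x y ≤ 0}
  have hsub : sphere 0 R ⊆ A ∪ IsometryEquiv.neg _ '' A := by
    intro y hy
    rcases le_total (inner ℝ x y) 0 with h | h
    · exact Or.inl ⟨hy, h⟩
    · refine Or.inr ⟨-y, ⟨by simpa using hy, by simpa using h⟩, by simp⟩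
  by_contra! h0
  have h := (measure_mono (μ := μH[(k : ℝ)]) hsub).trans (measure_union_le _ _)
  rw [IsometryEquiv.hausdorffMeasure_image, nonpos_iff_eq_zero.1 h0, add_zero] at h
  exact (hausdorffMeasure_sphere_pos hR).not_ge h

lemma sRatio_lt_one {n : ℕ} {x y : EuclideanSpace ℝ (Fin n)} (hR : 0 < R) (hx0 : 0 < ‖x‖)
    (hy : y ∈ sphere 0 R) (hxy : inner ℝ x y ≤ 0) : sRatio R x y < 1 := by
  rw [mem_sphere_zero_iff_norm] at hy
  have e := norm_sub_sq_real x y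
  rw [hy] at e
  have h1 := pow_pos hx0 2
  have h2 := pow_pos hR 2
  rw [sRatio, div_lt_one (by linarith), abs_lt]
  constructor <;> linarith

lemma integral_sRatio_lt (hR : 0 < R) (hx0 : 0 < ‖x‖) (hx : ‖x‖ ≠ R) {a b : ℝ}
    (hab : |a - k / 2| < |b - k / 2|) :
    ∫ y in sphere 0 R, sRatio R x y ^ a ∂μH[(k : ℝ)] <
      ∫ y in sphere 0 R, sRatio R x y ^ b ∂μH[(k : ℝ)] := by
  have hS : MeasurableSet (sphere (0 : EuclideanSpace ℝ (Fin (k + 1))) R) :=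
    isClosed_sphere.measurableSet
  have hi := fun c => integrableOn_sRatio_rpow hR hx c
  have e : ∀ c : ℝ, ∀ y ∈ sphere 0 R, sRatio R x y ^ c + sRatio R x y ^ (k - c) =
      2 * sRatio R x y ^ ((k : ℝ) / 2) * Real.cosh ((c - k / 2) * Real.log (sRatio R x y)) := by
    intro c y hy
    have h0 := sRatio_pos hR hx hy
    rw [Real.cosh_eq, Real.rpow_def_of_pos h0, Real.rpow_def_of_pos h0, Real.rpow_def_of_pos h0]
    have e1 : Real.log (sRatio R x y) * c = Real.log (sRatio R x y) * (k / 2) +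
      (c - k / 2) * Real.log (sRatio R x y) := by ring
    have e2 : Real.log (sRatio R x y) * (k - c) = Real.log (sRatio R x y) * (k / 2) +
      -((c - k / 2) * Real.log (sRatio R x y)) := by ring
    rw [e1, e2, Real.exp_add, Real.exp_add]
    ring
  have hsum : ∀ c : ℝ, ∫ y in sphere 0 R, (sRatio R x y ^ c + sRatio R x y ^ (k - c)) ∂μH[(k : ℝ)] =
      2 * ∫ y in sphere 0 R, sRatio R x y ^ c ∂μH[(k : ℝ)] := fun c => by
    rw [integral_add (hi c) (hi _), integral_sRatio_eq (Nat.cast_nonneg k) c hR hx, two_mul]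
  suffices H : ∫ y in sphere 0 R, (sRatio R x y ^ a + sRatio R x y ^ (k - a)) ∂μH[(k : ℝ)] <
      ∫ y in sphere 0 R, (sRatio R x y ^ b + sRatio R x y ^ (k - b)) ∂μH[(k : ℝ)] by
    rw [hsum, hsum] at H
    linarith
  have hadd : ∀ c : ℝ, IntegrableOn (fun y => sRatio R x y ^ c + sRatio R x y ^ (k - c))
      (sphere 0 R) μH[(k : ℝ)] := fun c => (hi c).add (hi _)
  rw [← sub_pos, ← integral_sub (hadd b) (hadd a)]
  refine (setIntegral_pos_iff_support_of_nonneg_ae ?_ ((hadd b).sub (hadd a))).2 ?_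
  · filter_upwards [ae_restrict_mem hS] with y hy
    refine sub_nonneg.2 ?_
    beta_reduce
    rw [e a y hy, e b y hy]
    have h0 := sRatio_pos hR hx hy
    refine mul_le_mul_of_nonneg_left (Real.cosh_le_cosh.2 ?_) (by positivity)
    rw [abs_mul, abs_mul]
    gcongr
  · refine (hausdorffMeasure_hemisphere_pos (x := x) hR).trans_le
      (measure_mono fun y hy => ⟨(sub_pos.2 ?_).ne', hy.1⟩)
    have h0 := sRatio_pos hR hx hy.1
    beta_reduce
    rw [e a y hy.1, e b y hy.1]
    refine mul_lt_mul_of_pos_left (Real.cosh_lt_cosh.2 ?_) (by positivity)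
    rw [abs_mul, abs_mul]
    have := abs_pos.2 (Real.log_neg h0 (sRatio_lt_one hR hx0 hy.1 hy.2)).ne
    gcongr

end

end

theorem stmt_1 (k : ℕ) (hk : 1 ≤ k) (R : ℝ) (hR : 0 < R)
    (x : EuclideanSpace ℝ (Fin (k + 1))) (hx0 : 0 < ‖x‖) (hx : ‖x‖ ≠ R)
    (α β : ℝ)
    (h : ∫ y in Metric.sphere (0 : EuclideanSpace ℝ (Fin (k + 1))) R,
            (sRatio R x y) ^ α ∂(μH[(k : ℝ)]) =
         ∫ y in Metric.sphere (0 : EuclideanSpace ℝ (Fin (k + 1))) R,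
            (sRatio R x y) ^ β ∂(μH[(k : ℝ)])) :
    α + β = k ∨ α = β := by
  rcases lt_trichotomy |α - k / 2| |β - k / 2| with hlt | heq | hlt
  · exact absurd h (integral_sRatio_lt hR hx0 hx hlt).ne
  · rcases abs_eq_abs.1 heq with h1 | h1
    · exact Or.inr (by linarith)
    · exact Or.inl (by linarith)
  · exact absurd h (integral_sRatio_lt hR hx0 hx hlt).ne'
end

section
/- Let k ≥ 1 be an integer, R > 0, and let x ∈ ℝ^{k+1} be a fixed point with 0 < |x| and |x| ≠ R. For every β ∈ ℂ, the set of complex numbers α satisfying ∫_{S^k(R)} ω(x,y)^α dS_y = ∫_{S^k(R)} ω(x,y)^β dS_y is infinite. -/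
open MeasureTheory

open Filter Topology

theorem exists_eq_pow_mul_of_differentiable {f : ℂ → ℂ} (hf : Differentiable ℂ f)
    (h0 : ∃ w, f w ≠ 0) (z₀ : ℂ) :
    ∃ (n : ℕ) (g : ℂ → ℂ), Differentiable ℂ g ∧ g z₀ ≠ 0 ∧ ∀ z, f z = (z - z₀) ^ n * g z := by
  obtain ⟨p, hp⟩ := hf.analyticAt z₀
  have hfa : AnalyticOnNhd ℂ f Set.univ := fun z _ => hf.analyticAt z
  have hp0 : p ≠ 0 := by
    intro h
    obtain ⟨w, hw⟩ := h0
    have h1 := hp.locally_zero_iff.2 h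
    exact hw (hfa.eqOn_zero_of_preconnected_of_frequently_eq_zero isPreconnected_univ
      (Set.mem_univ z₀) ((h1.filter_mono nhdsWithin_le_nhds).frequently) (Set.mem_univ w))
  have hdiff : ∀ n : ℕ, Differentiable ℂ ((Function.swap dslope z₀)^[n] f) := by
    intro n
    induction n with
    | zero => simpa using hf
    | succ n ih =>
      rw [Function.iterate_succ_apply']
      have := (Complex.differentiableOn_dslope (s := Set.univ) (c := z₀) Filter.univ_mem).2
        ih.differentiableOn
      exact differentiableOn_univ.1 this
  refine ⟨p.order, _, hdiff p.order, hp.iterate_dslope_fslope_ne_zero hp0, fun z => ?_⟩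
  simpa using hp.eq_pow_order_mul_iterate_dslope z

theorem exists_eq_monic_mul_of_finite_zeros {f : ℂ → ℂ} (hf : Differentiable ℂ f)
    (h0 : ∃ w, f w ≠ 0) (hfin : {z | f z = 0}.Finite) :
    ∃ (P : Polynomial ℂ) (g : ℂ → ℂ), P.Monic ∧ Differentiable ℂ g ∧ (∀ z, g z ≠ 0) ∧
      ∀ z, f z = P.eval z * g z := by
  generalize hs : {z | f z = 0} = s at hfin
  induction s, hfin using Set.Finite.induction_on generalizing f with
  | empty =>
    refine ⟨1, f, Polynomial.monic_one, hf, fun z hz => ?_, by simp⟩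
    have : z ∈ {z | f z = 0} := hz
    simp [hs] at this
  | @insert a s ha _ ih =>
    obtain ⟨n, g, hg, hga, hfg⟩ := exists_eq_pow_mul_of_differentiable hf h0 a
    have h0' : ∃ w, g w ≠ 0 := ⟨a, hga⟩
    obtain ⟨P, k, hP, hk, hk0, hgk⟩ := ih hg h0' (by
      ext z
      have hz : f z = 0 ↔ z ∈ insert a s := by rw [← hs]; rfl
      by_cases hza : z = a
      · subst hza
        simp [hga, ha]
      · rw [hfg z, mul_eq_zero, or_iff_right (pow_ne_zero _ (sub_ne_zero.2 hza))] at hz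
        simpa [hza] using hz)
    refine ⟨(Polynomial.X - Polynomial.C a) ^ n * P, k,
      ((Polynomial.monic_X_sub_C a).pow n).mul hP, hk, hk0, fun z => ?_⟩
    rw [hfg z, hgk z]
    simp [mul_assoc]

/-- A nowhere vanishing entire function has an entire logarithm. -/
theorem exists_exp_eq_of_differentiable {g : ℂ → ℂ} (hg : Differentiable ℂ g)
    (h0 : ∀ z, g z ≠ 0) : ∃ h : ℂ → ℂ, Differentiable ℂ h ∧ ∀ z, g z = Complex.exp (h z) := by
  have hq : Differentiable ℂ fun z => deriv g z / g z := hg.deriv.div hg h0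
  obtain ⟨h, hh0, hh⟩ := hq.isExactOn_univ.with_val_at 0 (Complex.log (g 0))
  have hh' : ∀ z, HasDerivAt h (deriv g z / g z) z := fun z => hh z (Set.mem_univ z)
  have hd : Differentiable ℂ h := fun z => (hh' z).differentiableAt
  refine ⟨h, hd, fun z => ?_⟩
  have hder : ∀ w, HasDerivAt (fun w => g w * Complex.exp (-h w)) 0 w := by
    intro w
    convert! (hg w).hasDerivAt.mul ((hh' w).neg.cexp) using 1
    field_simp [h0 w]
    ring
  have := is_const_of_deriv_eq_zero (fun w => (hder w).differentiableAt)
    (fun w => (hder w).deriv) z 0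
  simp only [hh0, Complex.exp_neg, Complex.exp_log (h0 0), mul_inv_cancel₀ (h0 0)] at this
  field_simp at this
  exact this

theorem eq_affine_of_re_le {h : ℂ → ℂ} (hd : Differentiable ℂ h) {M : ℝ}
    (hM : ∀ z, (h z).re ≤ M * (1 + ‖z‖)) : ∃ a b : ℂ, ∀ z, h z = a * z + b := by
  wlog hM0 : 0 < M generalizing M
  · exact this (M := 1) (fun z => (hM z).trans (by gcongr; linarith)) one_pos
  have hlin : ∀ z, ‖h z‖ ≤ (6 * M + 3 * ‖h 0‖) * (1 + ‖z‖) := by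
    intro z
    have hz := norm_nonneg z
    have := Complex.borelCaratheodory (f := h) (z := z) (R := 2 * (1 + ‖z‖))
      (M := M * (1 + 2 * (1 + ‖z‖))) (by positivity) hd.differentiableOn
      (fun w hw => (hM w).trans (by
        have : ‖w‖ < 2 * (1 + ‖z‖) := by simpa using hw
        gcongr)) (by positivity) (by simp; linarith)
    refine this.trans ?_
    rw [← add_div, div_le_iff₀ (by linarith)]
    nlinarith [norm_nonneg (h 0), mul_nonneg hz hz, mul_nonneg (norm_nonneg (h 0)) hz,
      mul_nonneg hM0.le hz, mul_nonneg hM0.le (mul_nonneg hz hz),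
      mul_nonneg (norm_nonneg (h 0)) (mul_nonneg hz hz)]
  set K := 6 * M + 3 * ‖h 0‖
  have hK : 0 ≤ K := by positivity
  have hderiv : ∀ z, ‖deriv h z‖ ≤ 2 * K := by
    intro z
    have hz := norm_nonneg z
    have := Complex.norm_deriv_le_of_forall_mem_sphere_norm_le (c := z) (R := 1 + ‖z‖)
      (C := 2 * K * (1 + ‖z‖)) (f := h) (by positivity) hd.diffContOnCl (fun w hw => by
        have h1 : ‖w‖ ≤ ‖z‖ + (1 + ‖z‖) := by
          have : ‖w - z‖ = 1 + ‖z‖ := by simpa [dist_eq_norm] using hw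
          linarith [norm_sub_norm_le w z]
        refine (hlin w).trans ?_
        rw [mul_comm 2 K, mul_assoc]
        gcongr
        linarith)
    rwa [mul_div_assoc, div_self (by positivity), mul_one] at this
  obtain ⟨a, ha⟩ := hd.deriv.exists_const_forall_eq_of_bounded
    (isBounded_iff_forall_norm_le.2 ⟨2 * K, by rintro _ ⟨z, rfl⟩; exact hderiv z⟩)
  refine ⟨a, h 0, fun z => ?_⟩
  have hder : ∀ w, HasDerivAt (fun w => h w - a * w) 0 w := by
    intro w
    convert! (hd w).hasDerivAt.sub ((hasDerivAt_id w).const_mul a) using 1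
    simp [ha]
  have := is_const_of_deriv_eq_zero (fun w => (hder w).differentiableAt)
    (fun w => (hder w).deriv) z 0
  simp only [mul_zero, sub_zero] at this
  rw [← this]; ring

/-- Hadamard's factorization theorem for entire functions of exponential type with finitely many
zeros. -/
theorem exists_eq_polynomial_mul_exp {f : ℂ → ℂ} (hf : Differentiable ℂ f)
    (h0 : ∃ w, f w ≠ 0) (hfin : {z | f z = 0}.Finite) {C A : ℝ}
    (hbd : ∀ z, ‖f z‖ ≤ C * Real.exp (A * ‖z‖)) :
    ∃ (P : Polynomial ℂ) (a : ℂ), ∀ z, f z = P.eval z * Complex.exp (a * z) := by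
  wlog hA : 0 ≤ A generalizing A
  · refine this (A := 0) (fun z => (hbd z).trans ?_) le_rfl
    have hC : 0 ≤ C := by simpa using (norm_nonneg (f 0)).trans (hbd 0)
    gcongr
    linarith
  obtain ⟨P, g, hP, hg, hg0, hfg⟩ := exists_eq_monic_mul_of_finite_zeros hf h0 hfin
  have hPev : ∀ᶠ z in cocompact ℂ, 1 ≤ ‖P.eval z‖ := by
    by_cases hdeg : 0 < P.degree
    · exact (P.tendsto_norm_atTop hdeg (tendsto_norm_cocompact_atTop)).eventually_ge_atTop 1
    · rw [Polynomial.eq_one_of_monic_natDegree_zero hP (by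
        rw [Polynomial.natDegree_eq_zero_iff_degree_le_zero]; exact not_lt.1 hdeg)]
      simp
  obtain ⟨s, hs, hs1⟩ := mem_cocompact.1 hPev
  obtain ⟨D, hD⟩ := hs.exists_bound_of_continuousOn hg.continuous.continuousOn
  have hgb : ∀ z, ‖g z‖ ≤ max 1 (max C D) * Real.exp (A * ‖z‖) := by
    intro z
    have he : 1 ≤ Real.exp (A * ‖z‖) := Real.one_le_exp (by positivity)
    by_cases hz : z ∈ s
    · calc ‖g z‖ ≤ max 1 (max C D) := (hD z hz).trans (by simp)
        _ ≤ _ := le_mul_of_one_le_right (by positivity) he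
    · have h1 : 1 ≤ ‖P.eval z‖ := hs1 hz
      calc ‖g z‖ ≤ ‖P.eval z‖ * ‖g z‖ := le_mul_of_one_le_left (norm_nonneg _) h1
        _ = ‖f z‖ := by rw [hfg z, norm_mul]
        _ ≤ C * Real.exp (A * ‖z‖) := hbd z
        _ ≤ _ := by gcongr; simp
  obtain ⟨h, hd, hgh⟩ := exists_exp_eq_of_differentiable hg hg0
  have hK : 0 < max 1 (max C D) := by positivity
  have hre : ∀ z, (h z).re ≤ (|Real.log (max 1 (max C D))| + A) * (1 + ‖z‖) := by
    intro z
    have := hgb z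
    rw [hgh z, Complex.norm_exp, ← Real.exp_log hK, ← Real.exp_add, Real.exp_le_exp] at this
    nlinarith [le_abs_self (Real.log (max 1 (max C D))), norm_nonneg z,
      mul_nonneg (abs_nonneg (Real.log (max 1 (max C D)))) (norm_nonneg z)]
  obtain ⟨a, b, hab⟩ := eq_affine_of_re_le hd hre
  refine ⟨P * Polynomial.C (Complex.exp b), a, fun z => ?_⟩
  rw [hfg, hgh, hab, Complex.exp_add]
  simp only [Polynomial.eval_mul, Polynomial.eval_C]
  ring

/-- If moreover the function is bounded on the imaginary axis, the polynomial is constant. -/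
theorem exists_eq_const_mul_exp {f : ℂ → ℂ} (hf : Differentiable ℂ f)
    (h0 : ∃ w, f w ≠ 0) (hfin : {z | f z = 0}.Finite) {C A K : ℝ}
    (hbd : ∀ z, ‖f z‖ ≤ C * Real.exp (A * ‖z‖))
    (him : ∀ y : ℝ, ‖f (y * Complex.I)‖ ≤ K) :
    ∃ d a : ℂ, ∀ z, f z = d * Complex.exp (a * z) := by
  obtain ⟨P, a, hP⟩ := exists_eq_polynomial_mul_exp hf h0 hfin hbd
  suffices hdeg : ¬ 0 < P.degree by
    rw [Polynomial.eq_C_of_degree_le_zero (not_lt.1 hdeg)] at hP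
    exact ⟨_, a, fun z => by rw [hP z, Polynomial.eval_C]⟩
  intro hdeg
  have hn : Tendsto (fun y : ℝ => ‖(y * Complex.I : ℂ)‖) atTop atTop := by
    simpa using tendsto_abs_atTop_atTop
  have hn' : Tendsto (fun y : ℝ => ‖((-y : ℝ) * Complex.I : ℂ)‖) atTop atTop := by
    simpa using tendsto_abs_atTop_atTop
  have ht := (P.tendsto_norm_atTop hdeg hn).atTop_mul_atTop₀ (P.tendsto_norm_atTop hdeg hn')
  obtain ⟨y, hy⟩ := (ht.eventually_gt_atTop (K * K)).exists
  have h1 : ‖f (y * Complex.I)‖ * ‖f ((-y : ℝ) * Complex.I)‖ ≤ K * K :=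
    mul_le_mul (him y) (him (-y)) (norm_nonneg _) ((norm_nonneg _).trans (him y))
  rw [← norm_mul, hP, hP, mul_mul_mul_comm, ← Complex.exp_add] at h1
  simp only [Complex.ofReal_neg, neg_mul, mul_neg, add_neg_cancel, Complex.exp_zero, mul_one,
    norm_mul] at h1
  simp only [Complex.ofReal_neg, neg_mul] at hy
  linarith

open ProbabilityTheory in
/-- If the bilateral Laplace transform of a bounded random variable takes some value only finitely
often, then the exponential of the variable takes at most one value besides `1`. -/
theorem exists_ae_exp_eq_one_or_eq_of_finite {Ω : Type*} [MeasurableSpace Ω] {μ : Measure Ω}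
    [IsFiniteMeasure μ] {X : Ω → ℝ} (hX : AEMeasurable X μ) {A : ℝ} (hA : ∀ᵐ ω ∂μ, |X ω| ≤ A)
    {c : ℂ} (hfin : {α | complexMGF X μ α = c}.Finite) :
    ∃ u : ℝ, ∀ᵐ ω ∂μ, Real.exp (X ω) = 1 ∨ Real.exp (X ω) = u := by
  have hint : ∀ t : ℝ, Integrable (fun ω => Real.exp (t * X ω)) μ := by
    intro t
    refine Integrable.of_bound (by fun_prop) (Real.exp (|t| * A)) ?_
    filter_upwards [hA] with ω hω
    rw [Real.norm_eq_abs, Real.abs_exp, Real.exp_le_exp]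
    calc t * X ω ≤ |t * X ω| := le_abs_self _
      _ = |t| * |X ω| := abs_mul _ _
      _ ≤ |t| * A := by gcongr
  have hset : integrableExpSet X μ = Set.univ := Set.eq_univ_of_forall hint
  have hdiff : Differentiable ℂ (complexMGF X μ) := by
    have := differentiableOn_complexMGF (X := X) (μ := μ)
    simpa [hset, differentiableOn_univ] using this
  have hbound : ∀ z : ℂ, ‖complexMGF X μ z‖ ≤ μ.real Set.univ * Real.exp (A * |z.re|) := by
    intro z
    rw [mul_comm]
    refine norm_integral_le_of_norm_le_const ?_
    filter_upwards [hA] with ω hω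
    rw [Complex.norm_exp, Real.exp_le_exp]
    simp only [Complex.re_mul_ofReal]
    calc z.re * X ω ≤ |z.re * X ω| := le_abs_self _
      _ = |z.re| * |X ω| := abs_mul _ _
      _ ≤ |z.re| * A := by gcongr
      _ = A * |z.re| := mul_comm _ _
  obtain ⟨d, a, hda⟩ : ∃ d a : ℂ, ∀ z, complexMGF X μ z - c = d * Complex.exp (a * z) := by
    refine exists_eq_const_mul_exp (f := fun z => complexMGF X μ z - c) (hdiff.sub_const c) ?_ ?_
      (C := μ.real Set.univ + ‖c‖) (A := |A|) (K := μ.real Set.univ + ‖c‖) ?_ ?_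
    · by_contra! h
      refine Set.infinite_univ (α := ℂ) (hfin.subset fun z _ => ?_)
      exact sub_eq_zero.1 (h z)
    · simpa [sub_eq_zero] using hfin
    · intro z
      have h1 : 1 ≤ Real.exp (|A| * ‖z‖) := Real.one_le_exp (by positivity)
      have h2 : Real.exp (A * |z.re|) ≤ Real.exp (|A| * ‖z‖) := by
        gcongr
        · exact le_abs_self A
        · exact Complex.abs_re_le_norm z
      calc _ ≤ ‖complexMGF X μ z‖ + ‖c‖ := norm_sub_le _ _
        _ ≤ μ.real Set.univ * Real.exp (|A| * ‖z‖) + ‖c‖ * Real.exp (|A| * ‖z‖) := by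
          gcongr
          · exact (hbound z).trans (by gcongr)
          · exact le_mul_of_one_le_right (norm_nonneg _) h1
        _ = _ := by ring
    · intro y
      refine (norm_sub_le _ _).trans ?_
      gcongr
      simpa using hbound (y * Complex.I)
  set U : Ω → ℝ := fun ω => Real.exp (X ω) with hU
  have hUpow : ∀ n : ℕ, (fun ω => Real.exp (n * X ω)) = fun ω => U ω ^ n := fun n =>
    funext fun ω => Real.exp_nat_mul _ _
  have hUint : ∀ n : ℕ, Integrable (fun ω => U ω ^ n) μ := fun n => hUpow n ▸ hint n
  have hpow : ∀ n : ℕ, ((∫ ω, U ω ^ n ∂μ : ℝ) : ℂ) = c + d * Complex.exp a ^ n := by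
    intro n
    have h1 := hda n
    have h2 := complexMGF_ofReal (X := X) (μ := μ) (n : ℝ)
    rw [mgf, hUpow] at h2
    rw [← h2, ← Complex.exp_nat_mul, mul_comm (n : ℂ) a, ← h1]
    push_cast
    ring
  set I : ℕ → ℝ := fun n => ∫ ω, U ω ^ n ∂μ with hI
  set m : ℕ → ℝ := fun n => I (n + 2) - 2 * I (n + 1) + I n with hm
  have hmc : ∀ n, (m n : ℂ) = d * (Complex.exp a - 1) ^ 2 * Complex.exp a ^ n := by
    intro n
    simp only [hm]
    push_cast
    rw [hpow, hpow, hpow]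
    ring
  have hmm : m 1 * m 1 = m 0 * m 2 := by
    have : ((m 1 * m 1 : ℝ) : ℂ) = (m 0 * m 2 : ℝ) := by
      push_cast
      rw [hmc, hmc, hmc]
      ring
    exact_mod_cast this
  have hmint : ∀ n, Integrable (fun ω => (U ω - 1) ^ 2 * U ω ^ n) μ ∧
      ∫ ω, (U ω - 1) ^ 2 * U ω ^ n ∂μ = m n := by
    intro n
    have he : (fun ω => (U ω - 1) ^ 2 * U ω ^ n) =
        fun ω => U ω ^ (n + 2) - 2 * U ω ^ (n + 1) + U ω ^ n := by
      funext ω; ring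
    have i1 := (hUint (n + 1)).const_mul 2
    have i2 : Integrable (fun ω => U ω ^ (n + 2) - 2 * U ω ^ (n + 1)) μ := (hUint (n + 2)).sub i1
    rw [he]
    refine ⟨i2.add (hUint n), ?_⟩
    rw [integral_add i2 (hUint n), integral_sub (hUint _) i1, integral_const_mul]
  by_cases hm0 : m 0 = 0
  · refine ⟨1, ?_⟩
    have := (integral_eq_zero_iff_of_nonneg (fun ω => by positivity) (hmint 0).1).1
      ((hmint 0).2.trans hm0)
    filter_upwards [this] with ω hω
    left
    have : (U ω - 1) ^ 2 * U ω ^ 0 = 0 := hω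
    exact sub_eq_zero.1 (by simpa using this)
  · refine ⟨m 1 / m 0, ?_⟩
    have he : (fun ω => (U ω - 1) ^ 2 * (m 0 * U ω - m 1) ^ 2) =
        fun ω => m 0 ^ 2 * ((U ω - 1) ^ 2 * U ω ^ 2) - 2 * m 0 * m 1 * ((U ω - 1) ^ 2 * U ω ^ 1) +
          m 1 ^ 2 * ((U ω - 1) ^ 2 * U ω ^ 0) := by
      funext ω; ring
    have j0 := (hmint 0).1.const_mul (m 1 ^ 2)
    have j1 := (hmint 1).1.const_mul (2 * m 0 * m 1)
    have j2 : Integrable (fun ω => m 0 ^ 2 * ((U ω - 1) ^ 2 * U ω ^ 2) -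
        2 * m 0 * m 1 * ((U ω - 1) ^ 2 * U ω ^ 1)) μ :=
      ((hmint 2).1.const_mul (m 0 ^ 2)).sub j1
    have hz : ∫ ω, (U ω - 1) ^ 2 * (m 0 * U ω - m 1) ^ 2 ∂μ = 0 := by
      rw [he, integral_add j2 j0, integral_sub ((hmint 2).1.const_mul (m 0 ^ 2)) j1,
        integral_const_mul, integral_const_mul, integral_const_mul, (hmint 0).2, (hmint 1).2,
        (hmint 2).2]
      linear_combination (-m 0) * hmm
    have := (integral_eq_zero_iff_of_nonneg (fun ω => by positivity)
      (by rw [he]; exact j2.add j0)).1 hz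
    filter_upwards [this] with ω hω
    have hω : (U ω - 1) ^ 2 * (m 0 * U ω - m 1) ^ 2 = 0 := hω
    rcases mul_eq_zero.1 hω with h | h
    · left
      exact sub_eq_zero.1 (pow_eq_zero_iff two_ne_zero |>.1 h)
    · right
      rw [eq_div_iff hm0, mul_comm]
      exact sub_eq_zero.1 (pow_eq_zero_iff two_ne_zero |>.1 h)

/-- If a relatively open nonempty subset of a sphere is null for a Hausdorff measure, so is the whole
sphere. -/
theorem hausdorffMeasure_sphere_eq_zero_of_isOpen {E : Type*} [NormedAddCommGroup E]
    [InnerProductSpace ℝ E] [FiniteDimensional ℝ E] [MeasurableSpace E] [BorelSpace E]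
    {d R : ℝ} (hd : 0 ≤ d) {V : Set E} (hV : IsOpen V)
    (hne : (Metric.sphere (0 : E) R ∩ V).Nonempty)
    (h0 : μH[d] (Metric.sphere (0 : E) R ∩ V) = 0) : μH[d] (Metric.sphere (0 : E) R) = 0 := by
  obtain ⟨v, hvS, hvV⟩ := hne
  refine measure_null_of_locally_null _ fun w hw => ?_
  have hn : ‖v‖ = ‖w‖ := by rw [mem_sphere_zero_iff_norm.1 hvS, mem_sphere_zero_iff_norm.1 hw]
  set ρ := (ℝ ∙ (v - w))ᗮ.reflection
  have hρ : ρ w = v := by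
    rw [← Submodule.reflection_sub hn, Submodule.reflection_reflection]
  refine ⟨ρ ⁻¹' (Metric.sphere (0 : E) R ∩ V), ?_, ?_⟩
  · rw [Set.preimage_inter]
    refine Filter.inter_mem ?_ (mem_nhdsWithin_of_mem_nhds
      ((hV.preimage ρ.continuous).mem_nhds (by simpa [hρ] using hvV)))
    filter_upwards [self_mem_nhdsWithin] with y hy
    simpa using hy
  · rw [ρ.isometry.hausdorffMeasure_preimage (Or.inl hd)]
    exact measure_mono_null Set.inter_subset_left h0

theorem stmt_2 (k : ℕ) (hk : 1 ≤ k) (R : ℝ) (hR : 0 < R)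
    (x : EuclideanSpace ℝ (Fin (k + 1))) (hx0 : 0 < ‖x‖) (hx : ‖x‖ ≠ R)
    (β : ℂ) :
    {α : ℂ |
      ∫ y in Metric.sphere (0 : EuclideanSpace ℝ (Fin (k + 1))) R,
          Complex.exp (α * (Real.log (sRatio R x y) : ℂ)) ∂(μH[(k : ℝ)]) =
      ∫ y in Metric.sphere (0 : EuclideanSpace ℝ (Fin (k + 1))) R,
          Complex.exp (β * (Real.log (sRatio R x y) : ℂ)) ∂(μH[(k : ℝ)])}.Infinite := by
  set S := Metric.sphere (0 : EuclideanSpace ℝ (Fin (k + 1))) R with hS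
  have hSc : IsCompact S := isCompact_sphere _ _
  set μ : Measure (EuclideanSpace ℝ (Fin (k + 1))) := μH[(k : ℝ)].restrict S with hμ
  have hnum : 0 < |‖x‖ ^ 2 - R ^ 2| := by
    rw [abs_pos, sub_ne_zero]
    exact fun h => hx ((pow_left_inj₀ hx0.le hR.le two_ne_zero).1 h)
  have hden : ∀ y ∈ S, ‖x - y‖ ^ 2 ≠ 0 := by
    intro y hy h
    rw [pow_eq_zero_iff two_ne_zero, norm_eq_zero, sub_eq_zero] at h
    exact hx (h ▸ mem_sphere_zero_iff_norm.1 hy)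
  have hpos : ∀ y ∈ S, 0 < sRatio R x y := fun y hy =>
    div_pos hnum (lt_of_le_of_ne (by positivity) (hden y hy).symm)
  have hcont : ContinuousOn (sRatio R x) S :=
    continuousOn_const.div (by fun_prop) hden
  have hlog : ContinuousOn (fun y => Real.log (sRatio R x y)) S :=
    hcont.log fun y hy => (hpos y hy).ne'
  obtain ⟨A, hA⟩ := hSc.exists_bound_of_continuousOn hlog
  have hAae : ∀ᵐ y ∂μ, |Real.log (sRatio R x y)| ≤ A :=
    (ae_restrict_iff' hSc.measurableSet).2 (Eventually.of_forall hA)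
  by_cases hfinm : IsFiniteMeasure μ
  swap
  · convert Set.infinite_univ (α := ℂ) using 1
    have hzero : ∀ α : ℂ, ∫ y, Complex.exp (α * (Real.log (sRatio R x y) : ℂ)) ∂μ = 0 := by
      intro α
      refine integral_undef fun hi => hfinm ?_
      have hc : Integrable (fun _ => Real.exp (-(|α.re| * A))) μ := by
        refine hi.norm.mono' (by fun_prop) ?_
        filter_upwards [hAae] with y hy
        rw [Real.norm_eq_abs, Real.abs_exp, Complex.norm_exp, Real.exp_le_exp,
          Complex.re_mul_ofReal, neg_le]
        calc _ ≤ |α.re * Real.log (sRatio R x y)| := neg_le_abs _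
          _ = |α.re| * |Real.log (sRatio R x y)| := abs_mul _ _
          _ ≤ _ := by gcongr
      exact (integrable_const_iff.1 hc).resolve_left (Real.exp_pos _).ne'
    exact Set.eq_univ_of_forall fun α => (hzero α).trans (hzero β).symm
  intro hfin
  have hrank : 1 < Module.rank ℝ (EuclideanSpace ℝ (Fin (k + 1))) := by
    rw [← Module.finrank_eq_rank, finrank_euclideanSpace_fin]
    exact_mod_cast Nat.lt_succ_of_le hk
  obtain ⟨u, hu⟩ := exists_ae_exp_eq_one_or_eq_of_finite
    (hlog.aemeasurable hSc.measurableSet) hAae hfin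
  have hu' : ∀ᵐ y ∂μ, sRatio R x y ∈ ({1, u} : Set ℝ) := by
    filter_upwards [hu, ae_restrict_mem hSc.measurableSet] with y hy hyS
    rwa [Real.exp_log (hpos y hyS)] at hy
  have hx0' := hx0.ne'
  have hnorm : ‖(R / ‖x‖) • x‖ = R := by
    rw [norm_smul, Real.norm_of_nonneg (by positivity)]
    field_simp
  have hy₁ : (R / ‖x‖) • x ∈ S := mem_sphere_zero_iff_norm.2 hnorm
  have hy₂ : -((R / ‖x‖) • x) ∈ S := mem_sphere_zero_iff_norm.2 (by rw [norm_neg, hnorm])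
  have hlt : sRatio R x (-((R / ‖x‖) • x)) < sRatio R x ((R / ‖x‖) • x) := by
    refine div_lt_div_of_pos_left hnum (lt_of_le_of_ne (by positivity) (hden _ hy₁).symm) ?_
    have e₁ : x - (R / ‖x‖) • x = (1 - R / ‖x‖) • x := by module
    have e₂ : x - -((R / ‖x‖) • x) = (1 + R / ‖x‖) • x := by module
    have hq : 0 < R / ‖x‖ := by positivity
    rw [e₁, e₂, norm_smul, norm_smul, mul_pow, mul_pow, Real.norm_eq_abs, Real.norm_eq_abs,
      sq_abs, sq_abs]
    gcongr 1
    nlinarith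
  obtain ⟨w, hw, hwu⟩ := (Set.Ioo_infinite hlt).exists_notMem_finite
    (Set.toFinite ({1, u} : Set ℝ))
  have hconn : IsPreconnected (sRatio R x '' S) := (isPreconnected_sphere hrank 0 R).image _ hcont
  obtain ⟨y, hyS, rfl⟩ := hconn.Icc_subset (Set.mem_image_of_mem _ hy₂)
    (Set.mem_image_of_mem _ hy₁) (Set.Ioo_subset_Icc_self hw)
  obtain ⟨V, hV, hVS⟩ := continuousOn_iff'.1 hcont ({1, u} : Set ℝ)ᶜ
    (Set.toFinite ({1, u} : Set ℝ)).isClosed.isOpen_compl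
  have hnull : μH[(k : ℝ)] (S ∩ V) = 0 := by
    rw [Set.inter_comm, ← hVS, ← Measure.restrict_apply' hSc.measurableSet]
    exact hu'
  have hS0 := hausdorffMeasure_sphere_eq_zero_of_isOpen k.cast_nonneg hV
    ⟨y, hyS, (hVS.subset ⟨hwu, hyS⟩).1⟩ hnull
  rw [← hS] at hS0
  refine Set.infinite_univ (α := ℂ) (hfin.subset fun α _ => ?_)
  simp [hμ, Measure.restrict_eq_zero.2 hS0]
end
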